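/- Let d ≥ 2, L_0 ≥ 1, n ≥ 1, x ∈ 𝓛_n = L_n ℤ^d, and let γ be a *-connected path in ℤ^d whose range {γ} intersects both S(x, L_n − 1) and S(x, 2L_n). Then there exists a family of points (y_m)_{m ∈ T_{(n)}} in {γ}, indexed by the 2^n leaves of the dyadic tree T_n, such that |y_m − y_{m'}| ≥ L_{ρ(m,m')−1} for all distinct leaves m, m' ∈ T_{(n)}; in particular {γ} contains 2^n points with pairwise ℓ∞-distances at least L_0. -/

import Mathlib

/-- The ℓ∞-norm on `ℤ^d`. -/
def linf {d : ℕ} (x : Fin d → ℤ) : ℤ := ((Finset.univ.sup fun i => (x i).natAbs : ℕ) : ℤ)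

/-- The ℓ∞-sphere `S(x,R)` in `ℤ^d`. -/
def sphereZ {d : ℕ} (x : Fin d → ℤ) (R : ℤ) : Set (Fin d → ℤ) := {y | linf (y - x) = R}

/-- The lattice `L ℤ^d`. -/
def lattice (d : ℕ) (L : ℤ) : Set (Fin d → ℤ) := {x | ∀ i, L ∣ x i}

/-- The scales `L_j = L_0 · 6^j`. -/
def Ln (L0 : ℤ) (j : ℕ) : ℤ := L0 * 6 ^ j

/-- Vertices of the dyadic tree `T_n`: sequences over `{1,2}` (here `Bool`)
of length at most `n`; the length is the depth of the vertex. -/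
def TreeVert (n : ℕ) := {l : List Bool // l.length ≤ n}

/-- `𝒯` is a proper embedding of `T_n` into `ℤ^d` with root at `x`:
(1) the root is mapped to `x`; (2) a vertex at depth `k` is mapped into `𝓛_{n-k}`;
(3) for a vertex `m` at depth `k < n`, its first child (append `false`) is at
ℓ∞-distance `L_{n-k}` from `m` and its second child (append `true`) is at
ℓ∞-distance `2 L_{n-k}` from `m`. -/
def ProperEmbedding (d n : ℕ) (L0 : ℤ) (x : Fin d → ℤ)
    (T : TreeVert n → (Fin d → ℤ)) : Prop :=
  T ⟨[], by simp⟩ = x ∧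
  (∀ (l : List Bool) (h : l.length ≤ n),
    T ⟨l, h⟩ ∈ lattice d (Ln L0 (n - l.length))) ∧
  (∀ (l : List Bool) (h : l.length < n),
    linf (T ⟨l ++ [false], by simpa using h⟩ - T ⟨l, h.le⟩) = Ln L0 (n - l.length) ∧
    linf (T ⟨l ++ [true], by simpa using h⟩ - T ⟨l, h.le⟩) = 2 * Ln L0 (n - l.length))

/-- `Λ_{n,x}`, the set of proper embeddings of `T_n` with root at `x`. -/
def Lambda (d n : ℕ) (L0 : ℤ) (x : Fin d → ℤ) : Set (TreeVert n → (Fin d → ℤ)) :=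
  {T | ProperEmbedding d n L0 x T}

/-- `γ : {0,…,l} → ℤ^d` is a `*`-connected path. -/
def StarPath {d : ℕ} (γ : ℕ → Fin d → ℤ) (l : ℕ) : Prop :=
  ∀ i, 1 ≤ i → i ≤ l → linf (γ i - γ (i - 1)) = 1

/-- The range `{γ}` of the path `γ : {0,…,l} → ℤ^d`. -/
def pathRange {d : ℕ} (γ : ℕ → Fin d → ℤ) (l : ℕ) : Set (Fin d → ℤ) :=
  γ '' {i | i ≤ l}

/-- The lexicographic distance `ρ(m,m')` of two leaves of `T_n`. -/
noncomputable def rho (n : ℕ) (m m' : List Bool) : ℕ :=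
  sInf {k | m.take (n - k) = m'.take (n - k)}

theorem linf_triangle {d : ℕ} (a b : Fin d → ℤ) : linf a ≤ linf b + linf (a - b) := by
  unfold linf
  norm_cast
  refine Finset.sup_le fun i _ => ?_
  have h1 := Finset.le_sup (f := fun i => (b i).natAbs) (Finset.mem_univ i)
  have h2 := Finset.le_sup (f := fun i => ((a - b) i).natAbs) (Finset.mem_univ i)
  simp only [Pi.sub_apply] at h1 h2 ⊢
  omega

theorem linf_sub_comm {d : ℕ} (a b : Fin d → ℤ) : linf (a - b) = linf (b - a) := by
  unfold linf
  congr 2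
  funext i
  simp only [Pi.sub_apply]
  omega

theorem abs_linf_sub_linf_le {d : ℕ} (a b : Fin d → ℤ) : |linf a - linf b| ≤ linf (a - b) := by
  have h1 := linf_triangle a b
  have h2 := linf_triangle b a
  rw [linf_sub_comm b a] at h2
  rw [abs_le]
  constructor <;> linarith

/-- Discrete intermediate value theorem, for an integer sequence with steps at most one. -/
theorem exists_eq_of_abs_step_le_one {l : ℕ} {f : ℕ → ℤ}
    (hf : ∀ k < l, |f (k + 1) - f k| ≤ 1) {i j : ℕ} (hij : i ≤ j) (hj : j ≤ l) {c : ℤ}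
    (hi : f i ≤ c) (hc : c ≤ f j) : ∃ k ≤ l, f k = c := by
  induction j, hij using Nat.le_induction with
  | base => exact ⟨i, hj, le_antisymm hi hc⟩
  | succ j _ ih =>
    by_cases h : c ≤ f j
    · exact ih (by omega) h
    · have h3 := abs_le.1 (hf j (by omega))
      exact ⟨j + 1, hj, by omega⟩

theorem StarPath.exists_linf_sub_eq {d : ℕ} {γ : ℕ → Fin d → ℤ} {l : ℕ} (hγ : StarPath γ l)
    (x : Fin d → ℤ) {i j : ℕ} (hi : i ≤ l) (hj : j ≤ l) {c : ℤ}
    (hic : linf (γ i - x) ≤ c) (hcj : c ≤ linf (γ j - x)) :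
    ∃ k ≤ l, linf (γ k - x) = c := by
  have hf : ∀ k < l, |linf (γ (k + 1) - x) - linf (γ k - x)| ≤ 1 := fun k hk => by
    have h1 := abs_linf_sub_linf_le (γ (k + 1) - x) (γ k - x)
    have h2 := hγ (k + 1) (by omega) hk
    rwa [sub_sub_sub_cancel_right, show linf (γ (k + 1) - γ k) = 1 from h2] at h1
  rcases le_total i j with hij | hij
  · exact exists_eq_of_abs_step_le_one (f := fun k => linf (γ k - x)) hf hij hj hic hcj
  · obtain ⟨k, hk, h⟩ := exists_eq_of_abs_step_le_one (f := fun k => -linf (γ k - x)) (c := -c)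
      (fun k hk => by
        have h := hf k hk
        rwa [abs_sub_comm, ← neg_sub_neg] at h)
      hij hi (neg_le_neg hcj) (neg_le_neg hic)
    exact ⟨k, hk, neg_injective h⟩

/-- Cantor-like position of a leaf, `2 ∑ b_j L_{n-j}` for the leaf `(b_1, …, b_n)`. -/
def leafOffset (L0 : ℤ) : List Bool → ℤ
  | [] => 0
  | b :: t => (if b then 2 * Ln L0 t.length else 0) + leafOffset L0 t

theorem Ln_succ (L0 : ℤ) (j : ℕ) : Ln L0 (j + 1) = 6 * Ln L0 j := by
  unfold Ln
  ring

theorem Ln_nonneg {L0 : ℤ} (h : 0 ≤ L0) (j : ℕ) : 0 ≤ Ln L0 j := by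
  unfold Ln
  positivity

theorem Ln_mono {L0 : ℤ} (h : 0 ≤ L0) : Monotone (Ln L0) := fun i j hij => by
  unfold Ln
  gcongr
  norm_num

theorem leafOffset_bounds {L0 : ℤ} (h : 0 ≤ L0) (m : List Bool) :
    0 ≤ leafOffset L0 m ∧ 5 * leafOffset L0 m ≤ 2 * Ln L0 m.length := by
  induction m with
  | nil => simpa [leafOffset] using Ln_nonneg h 0
  | cons b t ih =>
    have h0 := Ln_nonneg h t.length
    rw [List.length_cons, Ln_succ, leafOffset]
    split_ifs <;> omega

theorem rho_le {n k : ℕ} {m m' : List Bool} (h : m.take (n - k) = m'.take (n - k)) :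
    rho n m m' ≤ k :=
  Nat.sInf_le h

theorem rho_le_self (n : ℕ) (m m' : List Bool) : rho n m m' ≤ n :=
  rho_le (by simp)

theorem take_rho (n : ℕ) (m m' : List Bool) :
    m.take (n - rho n m m') = m'.take (n - rho n m m') :=
  Nat.sInf_mem (s := {k | m.take (n - k) = m'.take (n - k)}) ⟨n, by simp⟩

theorem rho_cons_le (n : ℕ) (b : Bool) (t t' : List Bool) :
    rho (n + 1) (b :: t) (b :: t') ≤ rho n t t' :=
  rho_le (by
    rw [Nat.sub_add_comm (rho_le_self n t t'), List.take_succ_cons, List.take_succ_cons,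
      take_rho])

theorem Ln_rho_le_abs_leafOffset_sub {L0 : ℤ} (h : 0 ≤ L0) {n : ℕ} {m m' : List Bool}
    (hm : m.length = n) (hm' : m'.length = n) (hne : m ≠ m') :
    Ln L0 (rho n m m' - 1) ≤ |leafOffset L0 m - leafOffset L0 m'| := by
  induction n generalizing m m' with
  | zero => exact absurd ((List.length_eq_zero_iff.1 hm).trans
      (List.length_eq_zero_iff.1 hm').symm) hne
  | succ n ih =>
    obtain ⟨b, t, rfl⟩ := List.exists_cons_of_length_eq_add_one hm
    obtain ⟨b', t', rfl⟩ := List.exists_cons_of_length_eq_add_one hm'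
    have ht : t.length = n := by simpa using hm
    have ht' : t'.length = n := by simpa using hm'
    by_cases hb : b = b'
    · subst hb
      have htt : t ≠ t' := fun e => hne (by rw [e])
      refine (Ln_mono h (Nat.sub_le_sub_right (rho_cons_le n b t t') 1)).trans ?_
      simpa [leafOffset, ht, ht'] using ih ht ht' htt
    · refine (Ln_mono h (Nat.sub_le_sub_right (rho_le_self _ _ _) 1)).trans ?_
      have h1 := leafOffset_bounds h t
      have h2 := leafOffset_bounds h t'
      have h0 := Ln_nonneg h n
      rw [ht] at h1
      rw [ht'] at h2
      rw [Nat.add_sub_cancel, le_abs]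
      cases b <;> cases b' <;> simp [leafOffset, ht, ht'] at hb ⊢ <;> omega

/-- if a `*`-connected path `γ` in `ℤ^d`, `d ≥ 2`, meets both
`S(x, L_n - 1)` and `S(x, 2 L_n)` for some `x ∈ 𝓛_n`, then `{γ}` contains a
family of points `(y_m)`, indexed by the `2^n` leaves `m ∈ T_{(n)}`, with
`|y_m - y_{m'}| ≥ L_{ρ(m,m') - 1}` for all distinct leaves `m, m'`; in
particular `{γ}` contains `2^n` points with pairwise ℓ∞-distances
at least `L_0`. -/
theorem path_crossing_contains_spread_out_points (d : ℕ) (hd : 2 ≤ d)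
    (L0 : ℤ) (hL0 : 1 ≤ L0) (n : ℕ) (hn : 1 ≤ n)
    (γ : ℕ → Fin d → ℤ) (l : ℕ) (hγ : StarPath γ l)
    (x : Fin d → ℤ) (hx : x ∈ lattice d (Ln L0 n))
    (h1 : (pathRange γ l ∩ sphereZ x (Ln L0 n - 1)).Nonempty)
    (h2 : (pathRange γ l ∩ sphereZ x (2 * Ln L0 n)).Nonempty) :
    ∃ y : List Bool → (Fin d → ℤ),
      (∀ m : List Bool, m.length = n → y m ∈ pathRange γ l) ∧
      (∀ m m' : List Bool, m.length = n → m'.length = n → m ≠ m' →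
        Ln L0 (rho n m m' - 1) ≤ linf (y m - y m')) := by
  obtain ⟨_, ⟨i, hi, rfl⟩, hri⟩ := h1
  obtain ⟨_, ⟨j, hj, rfl⟩, hrj⟩ := h2
  have h0 : 0 ≤ L0 := by omega
  have key : ∀ m : List Bool, ∃ k, m.length = n →
      k ≤ l ∧ linf (γ k - x) = Ln L0 n + leafOffset L0 m := fun m => by
    by_cases hm : m.length = n
    · have hb := leafOffset_bounds h0 m
      have hL := Ln_nonneg h0 n
      rw [hm] at hb
      have hri' : linf (γ i - x) = Ln L0 n - 1 := hri
      have hrj' : linf (γ j - x) = 2 * Ln L0 n := hrj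
      obtain ⟨k, hk⟩ := hγ.exists_linf_sub_eq x hi hj
        (c := Ln L0 n + leafOffset L0 m) (by omega) (by omega)
      exact ⟨k, fun _ => hk⟩
    · exact ⟨0, fun h => absurd h hm⟩
  choose k hk using key
  refine ⟨fun m => γ (k m), fun m hm => ⟨k m, (hk m hm).1, rfl⟩, fun m m' hm hm' hne => ?_⟩
  refine (Ln_rho_le_abs_leafOffset_sub h0 hm hm' hne).trans ?_
  have h := abs_linf_sub_linf_le (γ (k m) - x) (γ (k m') - x)
  rwa [(hk m hm).2, (hk m' hm').2, sub_sub_sub_cancel_right, add_sub_add_left_eq_sub] at h
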